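/- arXiv:2601.17501 — 2 statements merged into one kernel-verified Lean document; each statement's English description precedes it below -/
import Mathlib

section
/- Assume there exists p* ∈ (0,1) such that r is nonincreasing on (0,p*) and nondecreasing on (p*,1). Then X ≤_dmrl Y — i.e., the function p ↦ (∫_p¹ (1−q)·ψ'(q) dq)/(∫_p¹ (1−q)·φ'(q) dq) is monotone nondecreasing on (0,1) — if and only if lim_{p→0⁺} [ r(p)·(φ(p) − E[X]) − (ψ(p) − E[Y]) ] ≥ 0, where the limit exists in the extended reals [−∞,+∞]. (Corollary for the dmrl order when the quantile density ratio has exactly one mode, from decreasing to increasing.) -/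
open Set Filter Topology MeasureTheory intervalIntegral

theorem IntervalIntegrable.mono_Icc {f : ℝ → ℝ} {a b s t : ℝ} (hf : IntervalIntegrable f volume a b)
    (has : a ≤ s) (hst : s ≤ t) (htb : t ≤ b) : IntervalIntegrable f volume s t := by
  apply hf.mono_set
  rw [uIcc_of_le hst, uIcc_of_le (has.trans (hst.trans htb))]
  exact Icc_subset_Icc has htb

theorem intervalIntegrable_id_mul_of_one_sub_mul {f' : ℝ → ℝ} {t : ℝ} (ht : t ∈ Ioo (0:ℝ) 1)
    (hf' : IntervalIntegrable (fun q => (1 - q) * f' q) volume 0 1) :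
    IntervalIntegrable (fun q => q * f' q) volume 0 t := by
  have hc : ContinuousOn (fun q : ℝ => q / (1 - q)) (uIcc 0 t) := by
    rw [uIcc_of_le ht.1.le]
    refine continuousOn_id.div (by fun_prop) fun q hq => ?_
    have := hq.2
    have := ht.2
    linarith
  refine ((hf'.mono_Icc le_rfl ht.1.le ht.2.le).continuousOn_mul hc).congr fun q hq => ?_
  rw [uIoc_of_le ht.1.le] at hq
  have : 1 - q ≠ 0 := by linarith [hq.2, ht.2]
  field_simp

theorem tendsto_one_sub_mul_of_monotoneOn {f : ℝ → ℝ} (hf : MonotoneOn f (Ioo 0 1))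
    (hint : IntervalIntegrable f volume 0 1) :
    Tendsto (fun q => (1 - q) * f q) (𝓝[<] 1) (𝓝 0) := by
  have hlow : Tendsto (fun q : ℝ => (1 - q) * f (1 / 2)) (𝓝[<] 1) (𝓝 0) := by
    have : Continuous fun q : ℝ => (1 - q) * f (1 / 2) := by fun_prop
    simpa using (this.tendsto 1).mono_left nhdsWithin_le_nhds
  have hup : Tendsto (fun q : ℝ => ∫ x in q..1, f x) (𝓝[<] 1) (𝓝 0) := by
    have hc := continuousOn_primitive_interval_left (μ := volume) (f := f) (a := 0) (b := 1)
      (by rw [uIcc_of_le zero_le_one]; exact (intervalIntegrable_iff_integrableOn_Icc_of_le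
        zero_le_one).1 hint)
    have h1 := hc 1 right_mem_uIcc
    rw [uIcc_of_le zero_le_one] at h1
    have := h1.tendsto
    rw [integral_same] at this
    refine this.mono_left (nhdsWithin_le_iff.2 ?_)
    exact mem_of_superset (Ioo_mem_nhdsLT zero_lt_one) Ioo_subset_Icc_self
  refine tendsto_of_tendsto_of_tendsto_of_le_of_le' hlow hup ?_ ?_
  all_goals
    filter_upwards [Ioo_mem_nhdsLT (show (1 / 2 : ℝ) < 1 by norm_num)] with q hq
    have hq0 : 0 < q := by linarith [hq.1]
  · exact mul_le_mul_of_nonneg_left (hf (by norm_num) ⟨hq0, hq.2⟩ hq.1.le) (by linarith [hq.2])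
  · calc (1 - q) * f q = ∫ _ in q..1, f q := by simp
      _ ≤ ∫ x in q..1, f x :=
        integral_mono_on_of_le_Ioo hq.2.le (by simp) (hint.mono_Icc hq0.le hq.2.le le_rfl)
          fun x hx => hf ⟨hq0, hq.2⟩ ⟨hq0.trans hx.1, hx.2⟩ hx.1.le

theorem tendsto_primitive_nhdsGT_zero {f : ℝ → ℝ} {b : ℝ} (hb : 0 < b)
    (hint : IntervalIntegrable f volume 0 b) :
    Tendsto (fun q : ℝ => ∫ x in (0:ℝ)..q, f x) (𝓝[>] 0) (𝓝 0) := by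
  have hc := continuousOn_primitive_interval (μ := volume) (f := f) (a := 0) (b := b)
    (by rw [uIcc_of_le hb.le]; exact (intervalIntegrable_iff_integrableOn_Icc_of_le hb.le).1 hint)
  have h1 := hc 0 left_mem_uIcc
  rw [uIcc_of_le hb.le] at h1
  have := h1.tendsto
  rw [integral_same] at this
  refine this.mono_left (nhdsWithin_le_iff.2 ?_)
  exact mem_of_superset (Ioo_mem_nhdsGT hb) Ioo_subset_Icc_self

theorem tendsto_id_mul_of_monotoneOn {f : ℝ → ℝ} (hf : MonotoneOn f (Ioo 0 1))
    (hint : IntervalIntegrable f volume 0 1) :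
    Tendsto (fun q => q * f q) (𝓝[>] 0) (𝓝 0) := by
  have hup : Tendsto (fun q : ℝ => q * f (1 / 2)) (𝓝[>] 0) (𝓝 0) := by
    have : Continuous fun q : ℝ => q * f (1 / 2) := by fun_prop
    simpa using (this.tendsto 0).mono_left nhdsWithin_le_nhds
  refine tendsto_of_tendsto_of_tendsto_of_le_of_le'
    (tendsto_primitive_nhdsGT_zero zero_lt_one hint) hup ?_ ?_
  all_goals
    filter_upwards [Ioo_mem_nhdsGT (show (0 : ℝ) < 1 / 2 by norm_num)] with q hq
    have hq1 : q < 1 := by linarith [hq.2]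
  · calc ∫ x in (0:ℝ)..q, f x ≤ ∫ _ in (0:ℝ)..q, f q :=
        integral_mono_on_of_le_Ioo hq.1.le (hint.mono_Icc le_rfl hq.1.le hq1.le) (by simp)
          fun x hx => hf ⟨hx.1, hx.2.trans hq1⟩ ⟨hq.1, hq1⟩ hx.2.le
      _ = q * f q := by simp
  · exact mul_le_mul_of_nonneg_left (hf ⟨hq.1, hq1⟩ (by norm_num) hq.2.le) hq.1.le

/-- A quantile function minus its mean, written through its derivative. -/
theorem sub_integral_eq_of_monotoneOn {f f' : ℝ → ℝ} (hd : ∀ p ∈ Ioo (0:ℝ) 1, HasDerivAt f (f' p) p)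
    (hf : MonotoneOn f (Ioo 0 1)) (hint : IntervalIntegrable f volume 0 1)
    (hf' : IntervalIntegrable (fun q => (1 - q) * f' q) volume 0 1) {t : ℝ}
    (ht : t ∈ Ioo (0:ℝ) 1) :
    f t - ∫ q in (0:ℝ)..1, f q = (∫ q in (0:ℝ)..t, q * f' q) - ∫ q in t..1, (1 - q) * f' q := by
  have hfi0 := hint.mono_Icc le_rfl ht.1.le ht.2.le
  have hfi1 := hint.mono_Icc ht.1.le ht.2.le le_rfl
  have hi1 := hf'.mono_Icc ht.1.le ht.2.le le_rfl
  have hi0 := intervalIntegrable_id_mul_of_one_sub_mul ht hf'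
  have hcont := (hd t ht).continuousAt
  have e0 : ∫ q in (0:ℝ)..t, (f q + q * f' q) = t * f t - 0 := by
    refine integral_eq_sub_of_hasDerivAt_of_tendsto (f := fun q => q * f q) ht.1 (fun x hx => ?_)
      (hfi0.add hi0) (tendsto_id_mul_of_monotoneOn hf hint)
      ((continuousAt_id.mul hcont).tendsto.mono_left nhdsWithin_le_nhds)
    refine ((hasDerivAt_id x).mul (hd x ⟨hx.1, hx.2.trans ht.2⟩)).congr_deriv ?_
    simp
  have e1 : ∫ q in t..1, ((1 - q) * f' q - f q) = 0 - (1 - t) * f t := by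
    refine integral_eq_sub_of_hasDerivAt_of_tendsto (f := fun q => (1 - q) * f q) ht.2
      (fun x hx => ?_) (hi1.sub hfi1)
      (((continuousAt_const.sub continuousAt_id).mul hcont).tendsto.mono_left nhdsWithin_le_nhds)
      (tendsto_one_sub_mul_of_monotoneOn hf hint)
    refine (((hasDerivAt_id x).const_sub 1).mul (hd x ⟨ht.1.trans hx.1, hx.2⟩)).congr_deriv ?_
    simp
    ring
  rw [integral_add hfi0 hi0] at e0
  rw [integral_sub hi1 hfi1] at e1
  rw [← integral_add_adjacent_intervals hfi0 hfi1]
  linarith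

theorem stmt17
    (φ ψ φ' ψ' r : ℝ → ℝ)
    (hφd : ∀ p ∈ Ioo (0:ℝ) 1, HasDerivAt φ (φ' p) p)
    (hψd : ∀ p ∈ Ioo (0:ℝ) 1, HasDerivAt ψ (ψ' p) p)
    (hφ'pos : ∀ p ∈ Ioo (0:ℝ) 1, 0 < φ' p)
    (hψ'pos : ∀ p ∈ Ioo (0:ℝ) 1, 0 < ψ' p)
    (hr : ∀ p ∈ Ioo (0:ℝ) 1, r p = ψ' p / φ' p)
    (hrc : ContinuousOn r (Ioo 0 1))
    (hφint : IntervalIntegrable φ volume 0 1)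
    (hψint : IntervalIntegrable ψ volume 0 1)
    (hφ'int : IntervalIntegrable (fun q => (1-q) * φ' q) volume 0 1)
    (hψ'int : IntervalIntegrable (fun q => (1-q) * ψ' q) volume 0 1)
    (EX EY : ℝ)
    (hEX : EX = ∫ q in (0:ℝ)..1, φ q) (hEY : EY = ∫ q in (0:ℝ)..1, ψ q)
    (pstar : ℝ) (hpstar : pstar ∈ Ioo (0:ℝ) 1)
    (hrdown : AntitoneOn r (Ioo 0 pstar))
    (hrup : MonotoneOn r (Ioo pstar 1))
    (L : EReal)
    (hL : Tendsto (fun t => ((r t * (φ t - EX) - (ψ t - EY) : ℝ) : EReal))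
      (𝓝[>] (0:ℝ)) (𝓝 L)) :
    MonotoneOn (fun t => (∫ q in t..(1:ℝ), (1-q) * ψ' q) / (∫ q in t..(1:ℝ), (1-q) * φ' q)) (Ioo 0 1) ↔ 0 ≤ L := by
  have hφmono : MonotoneOn φ (Ioo 0 1) := monotoneOn_of_hasDerivWithinAt_nonneg (convex_Ioo 0 1)
    (fun x hx => (hφd x hx).continuousAt.continuousWithinAt)
    (fun x hx => (hφd x (interior_subset hx)).hasDerivWithinAt)
    (fun x hx => (hφ'pos x (interior_subset hx)).le)
  have hψmono : MonotoneOn ψ (Ioo 0 1) := monotoneOn_of_hasDerivWithinAt_nonneg (convex_Ioo 0 1)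
    (fun x hx => (hψd x hx).continuousAt.continuousWithinAt)
    (fun x hx => (hψd x (interior_subset hx)).hasDerivWithinAt)
    (fun x hx => (hψ'pos x (interior_subset hx)).le)
  have hψ'eq : ∀ p ∈ Ioo (0:ℝ) 1, ψ' p = r p * φ' p := fun p hp => by
    rw [hr p hp, div_mul_cancel₀ _ (hφ'pos p hp).ne']
  have hrpos : ∀ p ∈ Ioo (0:ℝ) 1, 0 < r p := fun p hp => by
    rw [hr p hp]
    exact div_pos (hψ'pos p hp) (hφ'pos p hp)
  have hrcp : Tendsto r (𝓝 pstar) (𝓝 (r pstar)) :=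
    hrc.continuousAt (Ioo_mem_nhds hpstar.1 hpstar.2)
  have hdown : ∀ s t, 0 < s → s ≤ t → t ≤ pstar → r t ≤ r s := by
    intro s t hs hst ht
    rcases hst.eq_or_lt with rfl | hst'
    · rfl
    rcases ht.eq_or_lt with rfl | ht'
    · refine le_of_tendsto (hrcp.mono_left (nhdsWithin_le_nhds (s := Iio t))) ?_
      filter_upwards [Ioo_mem_nhdsLT hst'] with x hx
      exact hrdown ⟨hs, hst'⟩ ⟨hs.trans hx.1, hx.2⟩ hx.1.le
    · exact hrdown ⟨hs, hst.trans_lt ht'⟩ ⟨hs.trans hst', ht'⟩ hst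
  have hup : ∀ s t, pstar ≤ s → s ≤ t → t < 1 → r s ≤ r t := by
    intro s t hs hst ht
    rcases hst.eq_or_lt with rfl | hst'
    · rfl
    rcases hs.eq_or_lt with rfl | hs'
    · refine le_of_tendsto (hrcp.mono_left (nhdsWithin_le_nhds (s := Ioi pstar))) ?_
      filter_upwards [Ioo_mem_nhdsGT hst'] with x hx
      exact hrup ⟨hx.1, hx.2.trans ht⟩ ⟨hst', ht⟩ hx.2.le
    · exact hrup ⟨hs', hst.trans_lt ht⟩ ⟨hs'.trans hst', ht⟩ hst
  set A : ℝ → ℝ := fun t => ∫ q in t..(1:ℝ), (1 - q) * ψ' q with hA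
  set B : ℝ → ℝ := fun t => ∫ q in t..(1:ℝ), (1 - q) * φ' q with hB
  have hBpos : ∀ t ∈ Ioo (0:ℝ) 1, 0 < B t := fun t ht =>
    intervalIntegral_pos_of_pos_on (hφ'int.mono_Icc ht.1.le ht.2.le le_rfl)
      (fun x hx => mul_pos (by linarith [hx.2]) (hφ'pos x ⟨ht.1.trans hx.1, hx.2⟩)) ht.2
  have hφst : ∀ s t, 0 < s → s < t → t ≤ 1 → 0 < ∫ q in s..t, (1 - q) * φ' q :=
    fun s t hs hst ht => intervalIntegral_pos_of_pos_on (hφ'int.mono_Icc hs.le hst.le ht)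
      (fun x hx => mul_pos (by linarith [hx.2])
        (hφ'pos x ⟨hs.trans hx.1, hx.2.trans_le ht⟩)) hst
  have hAsplit : ∀ s t, 0 < s → s ≤ t → t ≤ 1 → A s = (∫ q in s..t, (1 - q) * ψ' q) + A t :=
    fun s t hs hst ht => (integral_add_adjacent_intervals (hψ'int.mono_Icc hs.le hst ht)
      (hψ'int.mono_Icc (hs.le.trans hst) ht le_rfl)).symm
  have hBsplit : ∀ s t, 0 < s → s ≤ t → t ≤ 1 → B s = (∫ q in s..t, (1 - q) * φ' q) + B t :=
    fun s t hs hst ht => (integral_add_adjacent_intervals (hφ'int.mono_Icc hs.le hst ht)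
      (hφ'int.mono_Icc (hs.le.trans hst) ht le_rfl)).symm
  have hint_le : ∀ s t c, 0 < s → s ≤ t → t ≤ 1 → (∀ q ∈ Ioo s t, r q ≤ c) →
      ∫ q in s..t, (1 - q) * ψ' q ≤ c * ∫ q in s..t, (1 - q) * φ' q := by
    intro s t c hs hst ht hc
    rw [← intervalIntegral.integral_const_mul]
    refine integral_mono_on_of_le_Ioo hst (hψ'int.mono_Icc hs.le hst ht)
      ((hφ'int.mono_Icc hs.le hst ht).const_mul c) fun q hq => ?_
    have hq' : q ∈ Ioo (0:ℝ) 1 := ⟨hs.trans hq.1, hq.2.trans_le ht⟩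
    rw [hψ'eq q hq', mul_left_comm]
    exact mul_le_mul_of_nonneg_right (hc q hq)
      (mul_nonneg (by linarith [hq'.2]) (hφ'pos q hq').le)
  have hle_int : ∀ s t c, 0 < s → s ≤ t → t ≤ 1 → (∀ q ∈ Ioo s t, c ≤ r q) →
      c * ∫ q in s..t, (1 - q) * φ' q ≤ ∫ q in s..t, (1 - q) * ψ' q := by
    intro s t c hs hst ht hc
    rw [← intervalIntegral.integral_const_mul]
    refine integral_mono_on_of_le_Ioo hst ((hφ'int.mono_Icc hs.le hst ht).const_mul c)
      (hψ'int.mono_Icc hs.le hst ht) fun q hq => ?_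
    have hq' : q ∈ Ioo (0:ℝ) 1 := ⟨hs.trans hq.1, hq.2.trans_le ht⟩
    rw [hψ'eq q hq', mul_left_comm (1 - q)]
    exact mul_le_mul_of_nonneg_right (hc q hq)
      (mul_nonneg (by linarith [hq'.2]) (hφ'pos q hq').le)
  have hHup : ∀ t, pstar ≤ t → t < 1 → r t * B t ≤ A t := fun t ht ht1 =>
    hle_int t 1 (r t) (hpstar.1.trans_le ht) ht1.le le_rfl fun q hq => hup t q ht hq.1.le hq.2
  have hHmono : ∀ s t, 0 < s → s ≤ t → t ≤ pstar → A s - r s * B s ≤ A t - r t * B t := by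
    intro s t hs hst ht
    have ht1 := ht.trans_lt hpstar.2
    have h1 := hint_le s t (r s) hs hst ht1.le
      fun q hq => hdown s q hs hq.1.le (hq.2.le.trans ht)
    have h2 := mul_le_mul_of_nonneg_right (hdown s t hs hst ht) (hBpos t ⟨hs.trans_le hst, ht1⟩).le
    rw [hAsplit s t hs hst ht1.le, hBsplit s t hs hst ht1.le]
    linarith
  have hdmrl : MonotoneOn (fun t => A t / B t) (Ioo 0 1) ↔
      ∀ t ∈ Ioo (0:ℝ) 1, r t * B t ≤ A t := by
    constructor
    · intro hm t ht
      rcases le_or_gt pstar t with hp | hp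
      · exact hHup t hp ht.2
      by_contra! hlt
      have hlt' : A t / B t < r t := (div_lt_iff₀ (hBpos t ht)).2 hlt
      have hev : ∀ᶠ s in 𝓝[>] t, A t / B t < r s :=
        (((hrc.continuousAt (Ioo_mem_nhds ht.1 ht.2)).tendsto).mono_left
          nhdsWithin_le_nhds).eventually_const_lt hlt'
      obtain ⟨s, hs, hsI⟩ := (hev.and (Ioo_mem_nhdsGT hp)).exists
      have hs0 : 0 < s := ht.1.trans hsI.1
      have hs1 : s < 1 := hsI.2.trans hpstar.2
      have hms : A t / B t ≤ A s / B s := hm ht ⟨hs0, hs1⟩ hsI.1.le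
      rw [le_div_iff₀ (hBpos s ⟨hs0, hs1⟩)] at hms
      have h1 := hle_int t s (r s) ht.1 hsI.1.le hs1.le
        fun q hq => hdown q s (ht.1.trans hq.1) hq.2.le hsI.2.le
      have h2 := mul_lt_mul_of_pos_right hs (hφst t s ht.1 hsI.1 hs1.le)
      have h3 := div_mul_cancel₀ (A t) (hBpos t ht).ne'
      rw [hBsplit t s ht.1 hsI.1.le hs1.le, mul_add,
        ← hBsplit t s ht.1 hsI.1.le hs1.le] at h3
      have h4 := hAsplit t s ht.1 hsI.1.le hs1.le
      linarith
    · intro hH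
      have key : ∀ s t c, 0 < s → s ≤ t → t < 1 → (∀ q ∈ Ioo s t, r q ≤ c) →
          c * B t ≤ A t → A s / B s ≤ A t / B t := by
        intro s t c hs hst ht hc hct
        have hBt := hBpos t ⟨hs.trans_le hst, ht⟩
        rw [div_le_iff₀ (hBpos s ⟨hs, hst.trans_lt ht⟩), hAsplit s t hs hst ht.le,
          hBsplit s t hs hst ht.le, mul_add, div_mul_cancel₀ _ hBt.ne', add_le_add_iff_right]
        refine hint_le s t _ hs hst ht.le fun q hq => (hc q hq).trans ?_
        rwa [le_div_iff₀ hBt]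
      have hleft : ∀ s t, 0 < s → s ≤ t → t ≤ pstar → A s / B s ≤ A t / B t := by
        intro s t hs hst ht
        have ht1 := ht.trans_lt hpstar.2
        have hrs : ∀ q ∈ Ioo s t, r q ≤ r s :=
          fun q hq => hdown s q hs hq.1.le (hq.2.le.trans ht)
        refine key s t (r s) hs hst ht1 hrs ?_
        have h1 := hH s ⟨hs, hst.trans_lt ht1⟩
        rw [hAsplit s t hs hst ht1.le, hBsplit s t hs hst ht1.le] at h1
        have h2 := hint_le s t (r s) hs hst ht1.le hrs
        linarith
      have hright : ∀ s t, pstar ≤ s → s ≤ t → t < 1 → A s / B s ≤ A t / B t :=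
        fun s t hs hst ht => key s t (r t) (hpstar.1.trans_le hs) hst ht
          (fun q hq => hup q t (hs.trans hq.1.le) hq.2.le ht) (hHup t (hs.trans hst) ht)
      intro s hs t ht hst
      rcases le_total t pstar with h | h
      · exact hleft s t hs.1 hst h
      rcases le_total s pstar with h' | h'
      · exact (hleft s pstar hs.1 h' le_rfl).trans (hright pstar t le_rfl h ht.2)
      · exact hright s t h' hst ht.2
  have hM : ∀ t ∈ Ioo (0:ℝ) 1, r t * (φ t - EX) - (ψ t - EY) = (A t - r t * B t) -
      ((∫ q in (0:ℝ)..t, q * ψ' q) - r t * ∫ q in (0:ℝ)..t, q * φ' q) := by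
    intro t ht
    rw [hEX, hEY, sub_integral_eq_of_monotoneOn hφd hφmono hφint hφ'int ht,
      sub_integral_eq_of_monotoneOn hψd hψmono hψint hψ'int ht]
    ring
  refine hdmrl.trans ⟨fun hH => ?_, fun hL0 t ht => ?_⟩
  · have hlim := tendsto_primitive_nhdsGT_zero hpstar.1
      (intervalIntegrable_id_mul_of_one_sub_mul hpstar hψ'int)
    have hlim' : Tendsto (fun t : ℝ => ((-∫ q in (0:ℝ)..t, q * ψ' q : ℝ) : EReal)) (𝓝[>] 0)
        (𝓝 ((0 : ℝ) : EReal)) := by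
      refine (continuous_coe_real_ereal.tendsto 0).comp ?_
      simpa using hlim.neg
    refine le_of_tendsto_of_tendsto hlim' hL ?_
    filter_upwards [Ioo_mem_nhdsGT (zero_lt_one' ℝ)] with t ht
    rw [EReal.coe_le_coe_iff, hM t ht]
    have h1 := hH t ht
    have h2 : 0 ≤ ∫ q in (0:ℝ)..t, q * φ' q := by
      refine (intervalIntegral_pos_of_pos_on (intervalIntegrable_id_mul_of_one_sub_mul ht hφ'int)
        (fun q hq => mul_pos hq.1 (hφ'pos q ⟨hq.1, hq.2.trans ht.2⟩)) ht.1).le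
    have h3 := mul_nonneg (hrpos t ht).le h2
    linarith
  · rcases le_or_gt pstar t with hp | hp
    · exact hHup t hp ht.2
    have hLle : L ≤ ((A t - r t * B t : ℝ) : EReal) := by
      refine le_of_tendsto hL ?_
      filter_upwards [Ioo_mem_nhdsGT ht.1] with s hs
      have hs' : s ∈ Ioo (0:ℝ) 1 := ⟨hs.1, hs.2.trans ht.2⟩
      rw [EReal.coe_le_coe_iff, hM s hs']
      have h1 := hHmono s t hs.1 hs.2.le hp.le
      have h2 : r s * ∫ q in (0:ℝ)..s, q * φ' q ≤ ∫ q in (0:ℝ)..s, q * ψ' q := by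
        rw [← intervalIntegral.integral_const_mul]
        refine integral_mono_on_of_le_Ioo hs.1.le
          ((intervalIntegrable_id_mul_of_one_sub_mul hs' hφ'int).const_mul _)
          (intervalIntegrable_id_mul_of_one_sub_mul hs' hψ'int) fun q hq => ?_
        have hq' : q ∈ Ioo (0:ℝ) 1 := ⟨hq.1, hq.2.trans hs'.2⟩
        rw [hψ'eq q hq', mul_left_comm q]
        exact mul_le_mul_of_nonneg_right (hdown q s hq.1 hq.2.le (hs.2.trans hp).le)
          (mul_nonneg hq.1.le (hφ'pos q hq').le)
      linarith
    have h0 : (0 : ℝ) ≤ A t - r t * B t := by exact_mod_cast hL0.trans hLle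
    linarith
end

section
/- Suppose X has a bathtub (BT) hazard rate, i.e., there exists p* ∈ (0,1) such that h is nonincreasing on (0,p*) and nondecreasing on (p*,1). Then: (i) the mean residual quantile function m is monotone nonincreasing on (0,1) if and only if lim_{p→0⁺} h(p) ≤ 1/E[X] (the limit exists in (0,+∞] by monotonicity of h near 0); (ii) if lim_{p→0⁺} h(p) > 1/E[X], then there exists p₁ ∈ (0,1) such that m is nondecreasing on (0,p₁) and nonincreasing on (p₁,1), i.e., m is upside-down bathtub (UBT). -/
open Set Filter Topology MeasureTheory intervalIntegral

/-- Integration by parts: on `(0, 1)`, the weighted derivative `(1 - q) * deriv φ q` has the same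
integral as `φ`. -/
lemma integral_one_sub_mul_deriv_eq_integral {φ φ' : ℝ → ℝ}
    (hφd : ∀ p ∈ Ioo (0 : ℝ) 1, HasDerivAt φ (φ' p) p)
    (hφmono : MonotoneOn φ (Ioo 0 1))
    (hφ0 : Tendsto φ (𝓝[>] (0 : ℝ)) (𝓝 0))
    (hφint : IntervalIntegrable φ volume 0 1)
    (hwint : IntervalIntegrable (fun q => (1 - q) * φ' q) volume 0 1) :
    ∫ q in (0 : ℝ)..1, (1 - q) * φ' q = ∫ q in (0 : ℝ)..1, φ q := by
  have hderiv : ∀ p ∈ Ioo (0 : ℝ) 1,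
      HasDerivAt (fun q => (1 - q) * φ q) ((1 - p) * φ' p - φ p) p := by
    intro p hp
    refine (((hasDerivAt_id p).const_sub 1).mul (hφd p hp)).congr_deriv ?_
    simp only [id]
    ring
  have hzero : Tendsto (fun q => (1 - q) * φ q) (𝓝[>] (0 : ℝ)) (𝓝 0) := by
    have h1 : Tendsto (fun q : ℝ => 1 - q) (𝓝[>] (0 : ℝ)) (𝓝 (1 - 0)) :=
      ((continuous_const.sub continuous_id).tendsto 0).mono_left nhdsWithin_le_nhds
    simpa using h1.mul hφ0
  have hone : Tendsto (fun q => (1 - q) * φ q) (𝓝[<] (1 : ℝ)) (𝓝 0) := by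
    have hlo : Tendsto (fun q : ℝ => (1 - q) * φ (1 / 2)) (𝓝[<] (1 : ℝ)) (𝓝 0) := by
      have : Continuous (fun q : ℝ => (1 - q) * φ (1 / 2)) := by fun_prop
      simpa using (this.tendsto 1).mono_left nhdsWithin_le_nhds
    have hup : Tendsto (fun q : ℝ => ∫ x in q..1, φ x) (𝓝[<] (1 : ℝ)) (𝓝 0) := by
      have hc : ContinuousOn (fun q : ℝ => ∫ x in q..1, φ x) (uIcc 0 1) := by
        refine continuousOn_primitive_interval_left ?_
        rw [uIcc_of_le zero_le_one]
        exact (intervalIntegrable_iff_integrableOn_Icc_of_le zero_le_one).1 hφint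
      have := hc 1 right_mem_uIcc
      rw [uIcc_of_le zero_le_one] at this
      have h2 := this.tendsto
      simp only [integral_same] at h2
      refine h2.mono_left ?_
      rw [← nhdsWithin_Ioo_eq_nhdsLT (zero_lt_one' ℝ)]
      exact nhdsWithin_mono _ Ioo_subset_Icc_self
    have hmem : Ioo (1 / 2 : ℝ) 1 ∈ 𝓝[<] (1 : ℝ) := Ioo_mem_nhdsLT (by norm_num)
    refine tendsto_of_tendsto_of_tendsto_of_le_of_le' hlo hup ?_ ?_
    · filter_upwards [hmem] with q hq
      have := hφmono (a := 1 / 2) ⟨by norm_num, by norm_num⟩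
        (b := q) ⟨by linarith [hq.1], hq.2⟩ hq.1.le
      exact mul_le_mul_of_nonneg_left this (by linarith [hq.2])
    · filter_upwards [hmem] with q hq
      have hq0 : 0 < q := by linarith [hq.1]
      have : ∫ _ in q..1, φ q ≤ ∫ x in q..1, φ x := by
        refine integral_mono_on_of_le_Ioo hq.2.le intervalIntegrable_const ?_ ?_
        · refine hφint.mono_set ?_
          rw [uIcc_of_le zero_le_one, uIcc_of_le hq.2.le]
          exact Icc_subset_Icc_left hq0.le
        · exact fun x hx => hφmono ⟨hq0, hq.2⟩ ⟨hq0.trans hx.1, hx.2⟩ hx.1.le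
      simpa using this
  have key := integral_eq_sub_of_hasDerivAt_of_tendsto zero_lt_one hderiv
    (hwint.sub hφint) hzero hone
  rw [integral_sub hwint hφint] at key
  linarith

/-- The quantity with the sign of the derivative of `p ↦ (∫ q in p..1, w q) / (1 - p)`. -/
noncomputable def tailExcess (w : ℝ → ℝ) (p : ℝ) : ℝ := (∫ q in p..(1 : ℝ), w q) - (1 - p) * w p

lemma IntervalIntegrable.mono_of_zero_one {w : ℝ → ℝ} (hw : IntervalIntegrable w volume 0 1)
    {a b : ℝ} (ha : a ∈ Icc (0 : ℝ) 1) (hb : b ∈ Icc (0 : ℝ) 1) :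
    IntervalIntegrable w volume a b := by
  refine hw.mono_set ?_
  rw [uIcc_of_le zero_le_one]
  exact uIcc_subset_Icc ha hb

lemma hasDerivAt_tail_integral {w : ℝ → ℝ} (hc : ContinuousOn w (Ioo 0 1))
    (hw : IntervalIntegrable w volume 0 1)
    {p : ℝ} (hp : p ∈ Ioo (0 : ℝ) 1) :
    HasDerivAt (fun u => ∫ q in u..(1 : ℝ), w q) (-w p) p :=
  integral_hasDerivAt_left
    (hw.mono_of_zero_one (Ioo_subset_Icc_self hp) (right_mem_Icc.2 zero_le_one))
    (hc.stronglyMeasurableAtFilter isOpen_Ioo p hp)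
    (hc.continuousAt (isOpen_Ioo.mem_nhds hp))

lemma hasDerivAt_tail_mean {w : ℝ → ℝ} (hc : ContinuousOn w (Ioo 0 1))
    (hw : IntervalIntegrable w volume 0 1)
    {p : ℝ} (hp : p ∈ Ioo (0 : ℝ) 1) :
    HasDerivAt (fun u => (∫ q in u..(1 : ℝ), w q) / (1 - u)) (tailExcess w p / (1 - p) ^ 2) p := by
  refine ((hasDerivAt_tail_integral hc hw hp).div ((hasDerivAt_id p).const_sub 1)
    (by simpa [sub_eq_zero] using hp.2.ne')).congr_deriv ?_
  simp only [id, tailExcess]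
  ring

lemma continuousOn_tailExcess {w : ℝ → ℝ} (hc : ContinuousOn w (Ioo 0 1))
    (hw : IntervalIntegrable w volume 0 1) :
    ContinuousOn (tailExcess w) (Ioo 0 1) :=
  ContinuousOn.sub
    (fun _ hp => (hasDerivAt_tail_integral hc hw hp).continuousAt.continuousWithinAt)
    (((continuous_const.sub continuous_id).continuousOn).mul hc)

/-- On an interval where `w` is monotone, its tail excess is antitone. -/
lemma antitoneOn_tailExcess {w : ℝ → ℝ} (hw : IntervalIntegrable w volume 0 1)
    {s : Set ℝ} (hs : s ⊆ Ioo 0 1) (hs' : s.OrdConnected)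
    (hmono : MonotoneOn w s) : AntitoneOn (tailExcess w) s := by
  intro a ha b hb hab
  have ha' := Ioo_subset_Icc_self (hs ha)
  have hb' := Ioo_subset_Icc_self (hs hb)
  have hadd := integral_add_adjacent_intervals (hw.mono_of_zero_one ha' hb')
    (hw.mono_of_zero_one hb' (right_mem_Icc.2 zero_le_one))
  have hle : ∫ _ in a..b, w a ≤ ∫ q in a..b, w q :=
    integral_mono_on hab intervalIntegrable_const (hw.mono_of_zero_one ha' hb')
      fun x hx => hmono ha (hs'.out ha hb hx) hx.1
  rw [intervalIntegral.integral_const, smul_eq_mul] at hle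
  have := mul_le_mul_of_nonneg_left (hmono ha hb hab) (sub_nonneg.2 hb'.2)
  simp only [tailExcess]
  linarith

lemma tailExcess_nonpos_of_le {w : ℝ → ℝ} (hw : IntervalIntegrable w volume 0 1)
    {p : ℝ} (hp : p ∈ Ioo (0 : ℝ) 1)
    (hle : ∀ q ∈ Ioo p 1, w q ≤ w p) : tailExcess w p ≤ 0 := by
  have : ∫ q in p..1, w q ≤ ∫ _ in p..1, w p :=
    integral_mono_on_of_le_Ioo hp.2.le
      (hw.mono_of_zero_one (Ioo_subset_Icc_self hp) (right_mem_Icc.2 zero_le_one))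
      intervalIntegrable_const hle
  rw [intervalIntegral.integral_const, smul_eq_mul] at this
  simp only [tailExcess]
  linarith

/-- If `w` dominates its total integral on `(0, p]`, then its tail excess at `p` is nonpositive. -/
lemma tailExcess_nonpos_of_integral_le {w : ℝ → ℝ} (hw : IntervalIntegrable w volume 0 1)
    {p : ℝ} (hp : p ∈ Ioo (0 : ℝ) 1)
    (hle : ∀ q ∈ Ioc 0 p, ∫ x in (0 : ℝ)..1, w x ≤ w q) : tailExcess w p ≤ 0 := by
  have hp' := Ioo_subset_Icc_self hp
  have h0 := hw.mono_of_zero_one (left_mem_Icc.2 zero_le_one) hp'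
  have hadd := integral_add_adjacent_intervals h0
    (hw.mono_of_zero_one hp' (right_mem_Icc.2 zero_le_one))
  have hw_le : ∫ _ in (0 : ℝ)..p, (∫ x in (0 : ℝ)..1, w x) ≤ ∫ q in (0 : ℝ)..p, w q :=
    integral_mono_on_of_le_Ioo hp.1.le intervalIntegrable_const h0
      fun q hq => hle q ⟨hq.1, hq.2.le⟩
  rw [intervalIntegral.integral_const, smul_eq_mul] at hw_le
  have := mul_le_mul_of_nonneg_left (hle p ⟨hp.1, le_rfl⟩) (sub_nonneg.2 hp'.2)
  simp only [tailExcess]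
  linarith

/-- If the monotone function `w` drops below its total integral on `(0, b)`, then its tail excess
is positive somewhere there. -/
lemma exists_tailExcess_pos {w : ℝ → ℝ} (hw : IntervalIntegrable w volume 0 1)
    {b p₀ : ℝ} (hb : b ≤ 1) (hmono : MonotoneOn w (Ioo 0 b))
    (hp₀ : p₀ ∈ Ioo 0 b) (hw₀ : 0 ≤ w p₀) (hlt : w p₀ < ∫ x in (0 : ℝ)..1, w x) :
    ∃ p ∈ Ioo 0 b, 0 < tailExcess w p := by
  have hcont : ContinuousOn (fun u => ∫ x in u..(1 : ℝ), w x) (uIcc 0 1) := by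
    refine continuousOn_primitive_interval_left ?_
    rw [uIcc_of_le zero_le_one]
    exact (intervalIntegrable_iff_integrableOn_Icc_of_le zero_le_one).1 hw
  have ht : Tendsto (fun u => ∫ x in u..(1 : ℝ), w x) (𝓝[>] 0) (𝓝 (∫ x in (0 : ℝ)..1, w x)) := by
    refine (hcont 0 left_mem_uIcc).tendsto.mono_left ?_
    rw [uIcc_of_le zero_le_one, ← nhdsWithin_Ioo_eq_nhdsGT (zero_lt_one' ℝ)]
    exact nhdsWithin_mono _ Ioo_subset_Icc_self
  obtain ⟨p, hp, hpmem⟩ :=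
    ((ht.eventually (lt_mem_nhds hlt)).and (Ioo_mem_nhdsGT hp₀.1)).exists
  have hpb : p ∈ Ioo 0 b := ⟨hpmem.1, hpmem.2.trans hp₀.2⟩
  refine ⟨p, hpb, ?_⟩
  have h1 : (1 - p) * w p ≤ (1 - p) * w p₀ :=
    mul_le_mul_of_nonneg_left (hmono hpb hp₀ hpmem.2.le) (by linarith [hpb.2])
  have h2 : 0 ≤ p * w p₀ := mul_nonneg hpmem.1.le hw₀
  simp only [tailExcess]
  linarith

lemma antitoneOn_tail_mean {w : ℝ → ℝ} (hc : ContinuousOn w (Ioo 0 1))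
    (hw : IntervalIntegrable w volume 0 1)
    {a b : ℝ} (ha : 0 ≤ a) (hb : b ≤ 1)
    (hneg : ∀ p ∈ Ioo a b, tailExcess w p ≤ 0) :
    AntitoneOn (fun u => (∫ q in u..(1 : ℝ), w q) / (1 - u)) (Ioo a b) := by
  have hd : ∀ p ∈ Ioo a b, HasDerivAt (fun u => (∫ q in u..(1 : ℝ), w q) / (1 - u))
      (tailExcess w p / (1 - p) ^ 2) p :=
    fun p hp => hasDerivAt_tail_mean hc hw (Ioo_subset_Ioo ha hb hp)
  refine antitoneOn_of_deriv_nonpos (convex_Ioo a b)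
    (fun p hp => (hd p hp).continuousAt.continuousWithinAt) ?_ ?_ <;> rw [interior_Ioo]
  · exact fun p hp => (hd p hp).differentiableAt.differentiableWithinAt
  · intro p hp
    rw [(hd p hp).deriv]
    exact div_nonpos_of_nonpos_of_nonneg (hneg p hp) (sq_nonneg _)

lemma monotoneOn_tail_mean {w : ℝ → ℝ} (hc : ContinuousOn w (Ioo 0 1))
    (hw : IntervalIntegrable w volume 0 1)
    {a b : ℝ} (ha : 0 ≤ a) (hb : b ≤ 1)
    (hpos : ∀ p ∈ Ioo a b, 0 ≤ tailExcess w p) :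
    MonotoneOn (fun u => (∫ q in u..(1 : ℝ), w q) / (1 - u)) (Ioo a b) := by
  have hd : ∀ p ∈ Ioo a b, HasDerivAt (fun u => (∫ q in u..(1 : ℝ), w q) / (1 - u))
      (tailExcess w p / (1 - p) ^ 2) p :=
    fun p hp => hasDerivAt_tail_mean hc hw (Ioo_subset_Ioo ha hb hp)
  refine monotoneOn_of_deriv_nonneg (convex_Ioo a b)
    (fun p hp => (hd p hp).continuousAt.continuousWithinAt) ?_ ?_ <;> rw [interior_Ioo]
  · exact fun p hp => (hd p hp).differentiableAt.differentiableWithinAt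
  · intro p hp
    rw [(hd p hp).deriv]
    exact div_nonneg (hpos p hp) (sq_nonneg _)

lemma tailExcess_nonpos_of_antitoneOn {w : ℝ → ℝ} (hc : ContinuousOn w (Ioo 0 1))
    (hw : IntervalIntegrable w volume 0 1)
    (hanti : AntitoneOn (fun u => (∫ q in u..(1 : ℝ), w q) / (1 - u)) (Ioo 0 1))
    {p : ℝ} (hp : p ∈ Ioo (0 : ℝ) 1) : tailExcess w p ≤ 0 := by
  have h := hanti.derivWithin_nonpos (x := p)
  rw [derivWithin_of_isOpen isOpen_Ioo hp, (hasDerivAt_tail_mean hc hw hp).deriv] at h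
  have hpos : 0 < (1 - p) ^ 2 := pow_pos (sub_pos.2 hp.2) 2
  by_contra! hlt
  exact absurd h (div_pos hlt hpos).not_ge

/-- For `w` increasing then decreasing, the tail excess is nonpositive from the mode on. -/
lemma tailExcess_nonpos_of_antitoneOn_right {w : ℝ → ℝ} (hc : ContinuousOn w (Ioo 0 1))
    (hw : IntervalIntegrable w volume 0 1)
    {c p : ℝ} (hc0 : c ∈ Ioo (0 : ℝ) 1)
    (hanti : AntitoneOn w (Ioo c 1)) (hp : p ∈ Ico c 1) : tailExcess w p ≤ 0 := by
  have hIoo : ∀ q ∈ Ioo c 1, tailExcess w q ≤ 0 := fun q hq =>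
    tailExcess_nonpos_of_le hw ⟨hc0.1.trans hq.1, hq.2⟩
      fun x hx => hanti hq ⟨hq.1.trans hx.1, hx.2⟩ hx.1.le
  rcases hp.1.eq_or_lt with rfl | hlt
  · have ht := ((continuousOn_tailExcess hc hw).continuousAt
      (isOpen_Ioo.mem_nhds hc0)).tendsto.mono_left
      (nhdsWithin_le_nhds (s := Ioi c))
    refine le_of_tendsto ht ?_
    filter_upwards [Ioo_mem_nhdsGT hc0.2] with q hq using hIoo q hq
  · exact hIoo p ⟨hlt, hp.2⟩

/-- For `w` increasing on `(0, c)` and decreasing on `(c, 1)`, with a point of positive tail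
excess on `(0, c)`, the mean of `w` over `(p, 1)` increases and then decreases in `p`. -/
lemma exists_monotoneOn_antitoneOn_tail_mean {w : ℝ → ℝ} (hc : ContinuousOn w (Ioo 0 1))
    (hw : IntervalIntegrable w volume 0 1)
    {c a : ℝ} (hc0 : c ∈ Ioo (0 : ℝ) 1)
    (hmono : MonotoneOn w (Ioo 0 c)) (hanti : AntitoneOn w (Ioo c 1))
    (ha : a ∈ Ioo 0 c) (hpos : 0 < tailExcess w a) :
    ∃ p₁ ∈ Ioo (0 : ℝ) 1,
      MonotoneOn (fun u => (∫ q in u..(1 : ℝ), w q) / (1 - u)) (Ioo 0 p₁) ∧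
      AntitoneOn (fun u => (∫ q in u..(1 : ℝ), w q) / (1 - u)) (Ioo p₁ 1) := by
  have hcont := continuousOn_tailExcess hc hw
  have hsub : Ioo 0 c ⊆ Ioo (0 : ℝ) 1 := Ioo_subset_Ioo_right hc0.2.le
  have hG := antitoneOn_tailExcess hw hsub ordConnected_Ioo hmono
  have hright := fun p => tailExcess_nonpos_of_antitoneOn_right (p := p) hc hw hc0 hanti
  have hG' : AntitoneOn (tailExcess w) (Ioc 0 c) := by
    rw [← Ioo_insert_right hc0.1]
    refine (hG.dual_right.insert_of_continuousWithinAt ?_ ((hcont c hc0).mono hsub)).dual_right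
    rw [← mem_closure_iff_clusterPt, closure_Ioo hc0.1.ne]
    exact right_mem_Icc.2 hc0.1.le
  obtain ⟨p₁, hp₁, hzero⟩ := intermediate_value_Icc' ha.2.le
    (hcont.mono fun x hx => ⟨ha.1.trans_le hx.1, hx.2.trans_lt hc0.2⟩)
    ⟨hright c ⟨le_rfl, hc0.2⟩, hpos.le⟩
  have hp₁mem : p₁ ∈ Ioc 0 c := ⟨ha.1.trans_le hp₁.1, hp₁.2⟩
  refine ⟨p₁, ⟨hp₁mem.1, hp₁.2.trans_lt hc0.2⟩,
    monotoneOn_tail_mean hc hw le_rfl (hp₁.2.trans hc0.2.le) fun p hp => ?_,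
    antitoneOn_tail_mean hc hw hp₁mem.1.le le_rfl fun p hp => ?_⟩
  · exact hzero.symm.trans_le (hG' ⟨hp.1, hp.2.le.trans hp₁.2⟩ hp₁mem hp.2.le)
  · rcases le_or_gt c p with hcp | hpc
    · exact hright p ⟨hcp, hp.2⟩
    · exact (hG' hp₁mem ⟨hp₁mem.1.trans hp.1, hpc.le⟩ hp.1.le).trans_eq hzero

theorem stmt18
    (φ φ' h m : ℝ → ℝ)
    (hφd : ∀ p ∈ Ioo (0:ℝ) 1, HasDerivAt φ (φ' p) p)
    (hφ'pos : ∀ p ∈ Ioo (0:ℝ) 1, 0 < φ' p)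
    (hφ0 : Tendsto φ (𝓝[>] (0:ℝ)) (𝓝 0))
    (hφint : IntervalIntegrable φ volume 0 1)
    (EX : ℝ) (hEX : EX = ∫ q in (0:ℝ)..1, φ q) (hEXpos : 0 < EX)
    (hwint : IntervalIntegrable (fun q => (1-q) * φ' q) volume 0 1)
    (hh : ∀ p ∈ Ioo (0:ℝ) 1, h p = 1 / ((1-p) * φ' p))
    (hhc : ContinuousOn h (Ioo 0 1))
    (hm : ∀ p ∈ Ioo (0:ℝ) 1, m p = (∫ q in p..(1:ℝ), (1-q) * φ' q) / (1-p))
    (pstar : ℝ) (hpstar : pstar ∈ Ioo (0:ℝ) 1)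
    (hh1 : AntitoneOn h (Ioo 0 pstar)) (hh2 : MonotoneOn h (Ioo pstar 1))
    (L : EReal) (hL : Tendsto (fun p => (h p : EReal)) (𝓝[>] (0:ℝ)) (𝓝 L)) :
    (AntitoneOn m (Ioo 0 1) ↔ L ≤ ((1/EX : ℝ) : EReal)) ∧
    (((1/EX : ℝ) : EReal) < L →
      ∃ p₁ ∈ Ioo (0:ℝ) 1, MonotoneOn m (Ioo 0 p₁) ∧ AntitoneOn m (Ioo p₁ 1)) := by
  have hφmono : MonotoneOn φ (Ioo 0 1) := by
    refine monotoneOn_of_deriv_nonneg (convex_Ioo 0 1)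
      (fun p hp => (hφd p hp).continuousAt.continuousWithinAt) ?_ ?_ <;> rw [interior_Ioo]
    · exact fun p hp => (hφd p hp).differentiableAt.differentiableWithinAt
    · exact fun p hp => (hφd p hp).deriv ▸ (hφ'pos p hp).le
  set w : ℝ → ℝ := fun q => (1 - q) * φ' q
  have hmean : ∫ q in (0 : ℝ)..1, w q = EX :=
    (integral_one_sub_mul_deriv_eq_integral hφd hφmono hφ0 hφint hwint).trans hEX.symm
  have hwpos : ∀ p ∈ Ioo (0 : ℝ) 1, 0 < w p := fun p hp =>
    mul_pos (sub_pos.2 hp.2) (hφ'pos p hp)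
  have hhpos : ∀ p ∈ Ioo (0 : ℝ) 1, 0 < h p := fun p hp => by
    rw [hh p hp]
    exact one_div_pos.2 (hwpos p hp)
  have hwh : ∀ p ∈ Ioo (0 : ℝ) 1, w p = 1 / h p := fun p hp => by
    rw [hh p hp, one_div_one_div]
  have hwc : ContinuousOn w (Ioo 0 1) :=
    (continuousOn_const.div hhc fun p hp => (hhpos p hp).ne').congr hwh
  have hleft : Ioo 0 pstar ⊆ Ioo (0 : ℝ) 1 := Ioo_subset_Ioo_right hpstar.2.le
  have hwright : Ioo pstar 1 ⊆ Ioo (0 : ℝ) 1 := Ioo_subset_Ioo_left hpstar.1.le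
  have hw1 : MonotoneOn w (Ioo 0 pstar) := fun a ha b hb hab => by
    rw [hwh a (hleft ha), hwh b (hleft hb)]
    exact one_div_le_one_div_of_le (hhpos b (hleft hb)) (hh1 ha hb hab)
  have hw2 : AntitoneOn w (Ioo pstar 1) := fun a ha b hb hab => by
    rw [hwh a (hwright ha), hwh b (hwright hb)]
    exact one_div_le_one_div_of_le (hhpos a (hwright ha)) (hh2 ha hb hab)
  have hmem : Ioo 0 pstar ∈ 𝓝[>] (0 : ℝ) := Ioo_mem_nhdsGT hpstar.1
  have hL_le : L ≤ ((1 / EX : ℝ) : EReal) ↔ ∀ p ∈ Ioo 0 pstar, EX ≤ w p := by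
    have hle_iff : ∀ p ∈ Ioo 0 pstar, (h p ≤ 1 / EX ↔ EX ≤ w p) := fun p hp => by
      rw [hwh p (hleft hp), le_one_div (hhpos p (hleft hp)) hEXpos]
    constructor
    · intro hle p hp
      have hpL : (h p : EReal) ≤ L := by
        refine ge_of_tendsto hL ?_
        filter_upwards [Ioo_mem_nhdsGT hp.1] with q hq
        exact EReal.coe_le_coe_iff.2 (hh1 ⟨hq.1, hq.2.trans hp.2⟩ hp hq.2.le)
      exact (hle_iff p hp).1 (EReal.coe_le_coe_iff.1 (hpL.trans hle))
    · intro hle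
      refine le_of_tendsto hL ?_
      filter_upwards [hmem] with p hp
      exact EReal.coe_le_coe_iff.2 ((hle_iff p hp).2 (hle p hp))
  have hexists : ¬ L ≤ ((1 / EX : ℝ) : EReal) → ∃ p ∈ Ioo 0 pstar, 0 < tailExcess w p := by
    intro hlt
    rw [hL_le] at hlt
    push Not at hlt
    obtain ⟨p₀, hp₀, hlt⟩ := hlt
    exact exists_tailExcess_pos hwint hpstar.2.le hw1 hp₀ (hwpos p₀ (hleft hp₀)).le
      (hlt.trans_eq hmean.symm)
  have hmeq : EqOn m (fun u => (∫ q in u..(1 : ℝ), w q) / (1 - u)) (Ioo 0 1) := hm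
  refine ⟨⟨fun hanti => ?_, fun hle => ?_⟩, fun hlt => ?_⟩
  · by_contra hnle
    obtain ⟨p, hp, hpos⟩ := hexists hnle
    exact hpos.not_ge (tailExcess_nonpos_of_antitoneOn hwc hwint (hanti.congr hmeq) (hleft hp))
  · refine (antitoneOn_tail_mean hwc hwint le_rfl le_rfl fun p hp => ?_).congr hmeq.symm
    rcases le_or_gt pstar p with hcp | hpc
    · exact tailExcess_nonpos_of_antitoneOn_right hwc hwint hpstar hw2 ⟨hcp, hp.2⟩
    · refine tailExcess_nonpos_of_integral_le hwint hp fun q hq => ?_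
      exact hmean.trans_le (hL_le.1 hle q ⟨hq.1, hq.2.trans_lt hpc⟩)
  · obtain ⟨a, ha, hpos⟩ := hexists hlt.not_ge
    obtain ⟨p₁, hp₁, hinc, hdec⟩ :=
      exists_monotoneOn_antitoneOn_tail_mean hwc hwint hpstar hw1 hw2 ha hpos
    exact ⟨p₁, hp₁, hinc.congr (hmeq.symm.mono (Ioo_subset_Ioo_right hp₁.2.le)),
      hdec.congr (hmeq.symm.mono (Ioo_subset_Ioo_left hp₁.1.le))⟩
end
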